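/- Let q ≥ 3 be a power of an odd prime, let m > 2 be even, n = (q^m−1)/2, and let a ≥ 1, b ≥ 1 be integers with 1 ≤ a+b ≤ q−1 and ⌈(q−a−2)/2⌉ ≥ 1. Set δ̃ = a(q^m−1)/(q−1) + b(q^m−1)/(q^2−1) and δ = ⌈(δ̃+1)/2⌉. Then the negacyclic BCH code C_{(n,−1,δ,0)} over F_q has length n, minimum distance at least δ, and dimension k = Σ_{t=0}^{m/2} (m/(m−t)) binom(m−t, t) Σ_{j=0}^{t} binom(t, j) ⌊(q−a−b)/2⌋^j ⌈(q−a−b)/2⌉^{t−j} φ(t,j), where, writing E(t) = Σ_{i=0}^{m/2−t} binom(m−2t, 2i) ⌈(q−a−2)/2⌉^{2i} ⌊(q−a)/2⌋^{m−2t−2i} and O(t) = Σ_{i=0}^{m/2−t−1} binom(m−2t, 2i+1) ⌈(q−a−2)/2⌉^{2i+1} ⌊(q−a)/2⌋^{m−2t−2i−1}: if a is odd then φ(t,j) = E(t) when t and j have opposite parity and φ(t,j) = O(t) when t and j have the same parity; if a is even then φ(t,j) = E(t) when j is odd and φ(t,j) = O(t) when j is even. -/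

import Mathlib

open Finset

/-- The `q`-cyclotomic coset of `i` modulo `N`, as a subset of `ZMod N`. -/
def qCoset (q N i : ℕ) : Set (ZMod N) :=
  Set.range fun j : ℕ => (i : ZMod N) * (q : ZMod N) ^ j

/-- The odd `q`-cyclotomic coset leaders modulo `N`. -/
noncomputable def oddLeaders (q N : ℕ) : Finset ℕ := by
  classical
  exact (Finset.range N).filter fun s => Odd s ∧ ∀ j : ℕ, s ≤ (s * q ^ j) % N

/-- `x` is the `i`-th largest element of the finite set `S` (1-indexed). -/
def IsIthLargest (S : Finset ℕ) (i x : ℕ) : Prop :=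
  x ∈ S ∧ (S.filter fun y => x ≤ y).card = i

/-- Evaluation of the polynomial with coefficient vector `c` at the point `x`
of an extension field. -/
noncomputable def evalAt (F : Type*) {E : Type*} [Field F] [Field E] [Algebra F E]
    (n : ℕ) (x : E) : (Fin n → F) →ₗ[F] E where
  toFun c := ∑ j : Fin n, c j • x ^ (j : ℕ)
  map_add' a b := by simp [add_smul, Finset.sum_add_distrib]
  map_smul' r a := by simp [Finset.smul_sum, smul_smul]

/-- The negacyclic BCH code `C_(n,-1,δ,b)`: all words whose polynomial vanishes at
`γ^(1+2i)` for `b ≤ i ≤ b+δ-2`, where `γ` is a primitive `2n`-th root of unity. -/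
noncomputable def negaBCH (F : Type*) {E : Type*} [Field F] [Field E] [Algebra F E]
    (n : ℕ) (γ : E) (δ b : ℕ) : Submodule F (Fin n → F) :=
  ⨅ i ∈ Finset.Icc b (b + δ - 2), LinearMap.ker (evalAt F n (γ ^ (1 + 2 * i)))

/-- The cyclic BCH code `C_(n,1,δ,b)`: all words whose polynomial vanishes at
`β^i` for `b ≤ i ≤ b+δ-2`, where `β` is a primitive `n`-th root of unity. -/
noncomputable def cyclicBCH (F : Type*) {E : Type*} [Field F] [Field E] [Algebra F E]
    (n : ℕ) (β : E) (δ b : ℕ) : Submodule F (Fin n → F) :=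
  ⨅ i ∈ Finset.Icc b (b + δ - 2), LinearMap.ker (evalAt F n (β ^ i))

/-- The dual code under the standard inner product. -/
def dualCode {F : Type*} [Field F] {n : ℕ} (C : Submodule F (Fin n → F)) :
    Submodule F (Fin n → F) where
  carrier := {y | ∀ c ∈ C, ∑ j, y j * c j = 0}
  add_mem' := by
    intro a b ha hb c hc
    simp only [Set.mem_setOf_eq] at *
    simp [Pi.add_apply, add_mul, Finset.sum_add_distrib, ha c hc, hb c hc]
  zero_mem' := by intro c hc; simp
  smul_mem' := by
    intro r y hy c hc
    simp only [Set.mem_setOf_eq] at *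
    simp [Pi.smul_apply, smul_eq_mul, mul_assoc, ← Finset.mul_sum, hy c hc]

/-- The extended code of a code of length `n`. -/
def extendedCode {F : Type*} [Field F] {n : ℕ} (C : Submodule F (Fin n → F)) :
    Submodule F (Fin (n + 1) → F) where
  carrier := {x | (fun j : Fin n => x j.castSucc) ∈ C ∧ ∑ i, x i = 0}
  add_mem' := by
    intro a b ha hb
    exact ⟨C.add_mem ha.1 hb.1, by simp [Finset.sum_add_distrib, ha.2, hb.2]⟩
  zero_mem' := ⟨C.zero_mem, by simp⟩
  smul_mem' := by
    intro r x hx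
    exact ⟨C.smul_mem r hx.1, by simp [← Finset.mul_sum, hx.2]⟩

/-- Hamming weight of a word. -/
noncomputable def hWt {F : Type*} [Field F] {n : ℕ} (c : Fin n → F) : ℕ := by
  classical exact hammingNorm c

/-- `d` is the minimum Hamming distance of the code `C`. -/
def minDistIs {F : Type*} [Field F] {n : ℕ} (C : Submodule F (Fin n → F)) (d : ℕ) : Prop :=
  IsLeast {w : ℕ | ∃ c ∈ C, c ≠ 0 ∧ hWt c = w} d

/-- The bivariate Fibonacci-type polynomial `∑ C(m-t, t) x^(m-2t) y^t`. -/
def fibSum {R : Type*} [CommRing R] (x y : R) (m : ℕ) : R :=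
  ∑ p ∈ antidiagonal m, (p.1.choose p.2 : R) * x ^ (p.1 - p.2) * y ^ p.2

theorem fibSum_add_two {R : Type*} [CommRing R] (x y : R) (m : ℕ) :
    fibSum x y (m + 2) = x * fibSum x y (m + 1) + y * fibSum x y m := by
  have h1 : x * fibSum x y (m + 1) =
      x ^ (m + 2) + ∑ p ∈ antidiagonal m, (p.1.choose (p.2 + 1) : R) * x ^ (p.1 - p.2) *
        y ^ (p.2 + 1) := by
    rw [fibSum, Finset.Nat.antidiagonal_succ', Finset.sum_cons, Finset.sum_map, mul_add,
      Finset.mul_sum]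
    congr 1
    · simp [pow_succ]; ring
    · refine Finset.sum_congr rfl fun p _ => ?_
      simp only [Function.Embedding.prodMap, Function.Embedding.coeFn_mk, Prod.map,
        Function.Embedding.refl_apply]
      rcases Nat.lt_or_ge p.1 (p.2 + 1) with h | h
      · simp [Nat.choose_eq_zero_of_lt h]
      · have : p.1 - p.2 = p.1 - (p.2 + 1) + 1 := by omega
        simp only [Nat.succ_eq_add_one, this, pow_succ]
        ring
  rw [h1, fibSum, Finset.Nat.antidiagonal_succ_succ', Finset.sum_cons, Finset.sum_cons,
    Finset.sum_map, fibSum, Finset.mul_sum]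
  simp only [Function.Embedding.prodMap, Function.Embedding.coeFn_mk, Prod.map,
        Nat.succ_eq_add_one, Nat.choose_succ_succ, Nat.cast_add]
  have : ∑ p ∈ antidiagonal m, ((p.1.choose p.2 : R) + (p.1.choose (p.2 + 1) : R)) *
      x ^ (p.1 + 1 - (p.2 + 1)) * y ^ (p.2 + 1) =
      ∑ p ∈ antidiagonal m, (p.1.choose (p.2 + 1) : R) * x ^ (p.1 - p.2) * y ^ (p.2 + 1) +
      ∑ p ∈ antidiagonal m, y * ((p.1.choose p.2 : R) * x ^ (p.1 - p.2) * y ^ p.2) := by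
    rw [← Finset.sum_add_distrib]
    refine Finset.sum_congr rfl fun p _ => ?_
    rw [Nat.add_sub_add_right]
    ring
  rw [this]
  simp
  ring

theorem fibSum_eq_sum_range {R : Type*} [CommRing R] (x y : R) (m : ℕ) :
    fibSum x y m = ∑ t ∈ range (m / 2 + 1), ((m - t).choose t : R) * x ^ (m - 2 * t) * y ^ t := by
  rw [fibSum, ← Finset.Nat.sum_antidiagonal_swap, Finset.Nat.sum_antidiagonal_eq_sum_range_succ_mk]
  symm
  refine Finset.sum_subset_zero_on_sdiff (fun t ht => ?_) (fun t ht => ?_) (fun t ht => ?_)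
  · simp only [Finset.mem_range] at *; omega
  · simp only [Finset.mem_sdiff, Finset.mem_range] at ht
    simp [Nat.choose_eq_zero_of_lt (show m - t < t by omega)]
  · simp only [Prod.swap]
    rw [show m - t - t = m - 2 * t by omega]

theorem mul_choose_div_eq_choose_add_choose (m t : ℕ) (h : t < m) :
    (m + 1) * (m - t).choose (t + 1) / (m - t) = (m - t).choose (t + 1) + (m - 1 - t).choose t := by
  refine Nat.div_eq_of_eq_mul_right (by omega) ?_
  obtain ⟨s, rfl⟩ : ∃ s, m = t + 1 + s := ⟨m - t - 1, by omega⟩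
  have h1 : t + 1 + s - t = s + 1 := by omega
  have h2 : t + 1 + s - 1 - t = s := by omega
  rw [h1, h2, mul_add, Nat.add_one_mul_choose_eq]
  ring

theorem lucas_sum_eq {R : Type*} [CommRing R] (x y : R) (m : ℕ) :
    ∑ t ∈ range ((m + 2) / 2 + 1),
      ((m + 2) * Nat.choose (m + 2 - t) t / (m + 2 - t) : ℕ) * (x ^ (m + 2 - 2 * t) * y ^ t) =
      fibSum x y (m + 2) + y * fibSum x y m := by
  rw [fibSum_eq_sum_range, fibSum_eq_sum_range, Finset.sum_range_succ', Finset.sum_range_succ' _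
    ((m + 2) / 2), Finset.mul_sum, show (m + 2) / 2 = m / 2 + 1 by omega, add_right_comm,
    ← Finset.sum_add_distrib]
  congr 1
  · refine Finset.sum_congr rfl fun t ht => ?_
    have ht' : t < m / 2 + 1 := Finset.mem_range.1 ht
    have := mul_choose_div_eq_choose_add_choose (m + 1) t (by omega)
    rw [show m + 2 - (t + 1) = m + 1 - t by omega, this, show m + 1 - 1 - t = m - t by omega,
      show m + 2 - 2 * (t + 1) = m - 2 * t by omega]
    push_cast
    ring
  · simp

theorem matrix_pow_succ_apply {ι R : Type*} [Fintype ι] [DecidableEq ι] [CommRing R]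
    (A : Matrix ι ι R) (n : ℕ) (i k : ι) :
    (A ^ (n + 1)) i k = ∑ f : Fin n → ι, ∏ j : Fin (n + 1),
      A ((Fin.cons i f : Fin (n + 1) → ι) j) ((Fin.snoc f k : Fin (n + 1) → ι) j) := by
  induction n generalizing i with
  | zero => simp [Fin.snoc]
  | succ n ih =>
    rw [pow_succ', Matrix.mul_apply, ← (Fin.consEquiv fun _ => ι).sum_comp, Fintype.sum_prod_type]
    refine Finset.sum_congr rfl fun l _ => ?_
    rw [ih, Finset.mul_sum]
    refine Finset.sum_congr rfl fun f _ => ?_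
    have : (Fin.snoc (Fin.cons l f : Fin (n + 1) → ι) k : Fin (n + 2) → ι) =
      Fin.cons l (Fin.snoc f k : Fin (n + 1) → ι) := (Fin.cons_snoc_eq_snoc_cons _ _ _).symm
    rw [Fin.prod_univ_succ (n := n + 1)]
    simp [Fin.consEquiv, this]

theorem trace_pow_succ_eq_sum_cyclic {ι R : Type*} [Fintype ι] [DecidableEq ι] [CommRing R]
    (A : Matrix ι ι R) (n : ℕ) :
    (A ^ (n + 1)).trace = ∑ f : Fin (n + 1) → ι, ∏ j, A (f j) (f (j + 1)) := by
  rw [Matrix.trace, ← (Fin.consEquiv fun _ => ι).sum_comp, Fintype.sum_prod_type]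
  refine Finset.sum_congr rfl fun i _ => ?_
  rw [Matrix.diag_apply, matrix_pow_succ_apply]
  refine Finset.sum_congr rfl fun f _ => Finset.prod_congr rfl fun j _ => ?_
  congr 1
  induction j using Fin.lastCases with
  | last => simp [Fin.consEquiv]
  | cast j => simp [Fin.consEquiv, Fin.coeSucc_eq_succ]

theorem trace_pow_add_two_fin_two {R : Type*} [CommRing R] (u v x : R) (m : ℕ) :
    ((!![0, u; v, x] : Matrix (Fin 2) (Fin 2) R) ^ (m + 2)).trace =
      fibSum x (u * v) (m + 2) + u * v * fibSum x (u * v) m := by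
  set M : Matrix (Fin 2) (Fin 2) R := !![0, u; v, x] with hM
  have hsq : M ^ 2 = x • M + (u * v) • 1 := by
    ext i j
    fin_cases i <;> fin_cases j <;> simp [hM, sq, Matrix.mul_apply] <;> ring
  have hrec (k : ℕ) : (M ^ (k + 2)).trace = x * (M ^ (k + 1)).trace + u * v * (M ^ k).trace := by
    rw [pow_add, hsq, mul_add, Matrix.trace_add, Matrix.mul_smul, Matrix.mul_smul,
      Matrix.trace_smul, Matrix.trace_smul, mul_one, pow_succ, smul_eq_mul, smul_eq_mul]
  have h0 : (M ^ 0).trace = 2 := by simp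
  have h1 : (M ^ 1).trace = x := by simp [hM, Matrix.trace_fin_two]
  have f0 : fibSum x (u * v) 0 = 1 := by simp [fibSum]
  have f1 : fibSum x (u * v) 1 = x := by simp [fibSum, Finset.Nat.antidiagonal_succ]
  induction m using Nat.strong_induction_on with
  | _ m ih =>
    match m with
    | 0 => rw [hrec, h0, zero_add, h1, fibSum_add_two, f0, f1]; ring
    | 1 =>
      rw [hrec, hrec, h0, zero_add, h1, fibSum_add_two, fibSum_add_two x _ 0, zero_add, f0, f1]
      ring
    | k + 2 =>
      rw [hrec, ih (k + 1) (by omega), ih k (by omega), fibSum_add_two x _ (k + 2),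
        fibSum_add_two x _ k, show k + 1 + 2 = k + 3 from rfl, show k + 2 + 1 = k + 3 from rfl]
      ring

theorem sum_range_two_mul_add_one {R : Type*} [AddCommMonoid R] (f : ℕ → R) (s : ℕ) :
    ∑ i ∈ range (2 * s + 1), f i =
      ∑ i ∈ range (s + 1), f (2 * i) + ∑ i ∈ range s, f (2 * i + 1) := by
  induction s with
  | zero => simp
  | succ s ih =>
    rw [show 2 * (s + 1) + 1 = 2 * s + 1 + 1 + 1 by ring, Finset.sum_range_succ,
      Finset.sum_range_succ, ih, Finset.sum_range_succ _ (s + 1), Finset.sum_range_succ _ s,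
      Finset.sum_range_succ _ s, show 2 * s + 1 + 1 = 2 * (s + 1) by ring]
    abel

theorem even_part_add_odd_part (o e : ℤ) (s : ℕ) :
    ∑ i ∈ range (s + 1), (Nat.choose (2 * s) (2 * i) : ℤ) * o ^ (2 * i) * e ^ (2 * s - 2 * i) +
      ∑ i ∈ range s, (Nat.choose (2 * s) (2 * i + 1) : ℤ) * o ^ (2 * i + 1) *
        e ^ (2 * s - 2 * i - 1) = (e + o) ^ (2 * s) := by
  rw [add_comm e o, add_pow, sum_range_two_mul_add_one]
  congr 1 <;> refine Finset.sum_congr rfl fun i _ => ?_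
  · ring
  · rw [Nat.sub_sub]; ring

theorem even_part_sub_odd_part (o e : ℤ) (s : ℕ) :
    ∑ i ∈ range (s + 1), (Nat.choose (2 * s) (2 * i) : ℤ) * o ^ (2 * i) * e ^ (2 * s - 2 * i) -
      ∑ i ∈ range s, (Nat.choose (2 * s) (2 * i + 1) : ℤ) * o ^ (2 * i + 1) *
        e ^ (2 * s - 2 * i - 1) = (e - o) ^ (2 * s) := by
  rw [sub_eq_add_neg e o, ← even_part_add_odd_part, sub_eq_add_neg, ← Finset.sum_neg_distrib]
  congr 1 <;> refine Finset.sum_congr rfl fun i _ => ?_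
  · rw [(even_two_mul i).neg_pow]
  · rw [(odd_two_mul_add_one i).neg_pow]; ring

theorem two_mul_parity_part (o e : ℤ) (s a t j : ℕ) :
    2 * (if (if Odd a then (t + j) % 2 = 1 else j % 2 = 1) then
        ∑ i ∈ range (s + 1), (Nat.choose (2 * s) (2 * i) : ℤ) * o ^ (2 * i) * e ^ (2 * s - 2 * i)
      else ∑ i ∈ range s, (Nat.choose (2 * s) (2 * i + 1) : ℤ) * o ^ (2 * i + 1) *
        e ^ (2 * s - 2 * i - 1)) =
      (e + o) ^ (2 * s) - ((-1) ^ a) ^ t * (-1) ^ j * (e - o) ^ (2 * s) := by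
  rw [← even_part_add_odd_part, ← even_part_sub_odd_part]
  by_cases ha : Odd a
  · simp only [if_pos ha]
    rw [ha.neg_one_pow, ← pow_add]
    split_ifs with h
    · rw [(Nat.odd_iff.2 h).neg_one_pow]; ring
    · rw [(Nat.even_iff.2 (by omega : (t + j) % 2 = 0)).neg_one_pow]; ring
  · simp only [if_neg ha]
    rw [(Nat.not_odd_iff_even.1 ha).neg_one_pow, one_pow, one_mul]
    split_ifs with h
    · rw [(Nat.odd_iff.2 h).neg_one_pow]; ring
    · rw [(Nat.even_iff.2 (by omega : j % 2 = 0)).neg_one_pow]; ring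

theorem two_mul_sum_choose_parity_part (o e o' e' : ℤ) (s a t : ℕ) :
    2 * ∑ j ∈ range (t + 1), (Nat.choose t j : ℤ) * o' ^ j * e' ^ (t - j) *
      (if (if Odd a then (t + j) % 2 = 1 else j % 2 = 1) then
        ∑ i ∈ range (s + 1), (Nat.choose (2 * s) (2 * i) : ℤ) * o ^ (2 * i) * e ^ (2 * s - 2 * i)
      else ∑ i ∈ range s, (Nat.choose (2 * s) (2 * i + 1) : ℤ) * o ^ (2 * i + 1) *
        e ^ (2 * s - 2 * i - 1)) =
      (e + o) ^ (2 * s) * (e' + o') ^ t -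
        (e - o) ^ (2 * s) * ((-1) ^ a * (e' - o')) ^ t := by
  rw [add_comm e' o', add_pow o' e', sub_eq_neg_add e' o', mul_pow, add_pow (-o') e', Finset.mul_sum,
    Finset.mul_sum, Finset.mul_sum, Finset.mul_sum, ← Finset.sum_sub_distrib]
  refine Finset.sum_congr rfl fun j _ => ?_
  rw [mul_left_comm, two_mul_parity_part, neg_pow o']
  ring

theorem sum_Ico_neg_one_pow {q c : ℕ} (hq : Odd q) (hc : c ≤ q) :
    ∑ u ∈ Ico c q, (-1 : ℤ) ^ u = ((q - c + 1) / 2 : ℕ) - ((q - c) / 2 : ℕ) := by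
  obtain ⟨d, rfl⟩ := Nat.exists_eq_add_of_le hc
  have key : ∑ u ∈ Ico c (c + d), (-1 : ℤ) ^ u = (-1) ^ c * if Odd d then 1 else 0 := by
    clear hq hc
    induction d with
    | zero => simp
    | succ d ih =>
      rw [← add_assoc, Finset.sum_Ico_succ_top (by omega), ih, pow_add]
      by_cases h : Odd d
      · simp [h, h.neg_one_pow, Nat.odd_add_one]
      · simp [h, (Nat.not_odd_iff_even.1 h).neg_one_pow, Nat.odd_add_one]
  rw [key, Nat.add_sub_cancel_left]
  by_cases h : Odd d
  · have hc : Even c := by by_contra hc; grind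
    rw [if_pos h, hc.neg_one_pow]
    obtain ⟨r, rfl⟩ := h
    rw [show (2 * r + 1 + 1) / 2 = r + 1 by omega, show (2 * r + 1) / 2 = r by omega]
    push_cast; ring
  · rw [if_neg h]
    obtain ⟨r, rfl⟩ := even_iff_exists_two_mul.1 (Nat.not_odd_iff_even.1 h)
    rw [show (2 * r + 1) / 2 = r by omega, show (2 * r) / 2 = r by omega]
    ring

/-- Cyclic words over `Fin q` all of whose adjacent pairs, read as two-digit numbers in base `q`
with the later letter leading, are at least the number with digits `a`, `a + b`. -/
theorem sum_cyclic_words_prod_pow {q a b : ℕ} (hb : 1 ≤ b) (hab : a + b ≤ q - 1) (m : ℕ) (ε : ℤ) :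
    ∑ f : Fin (m + 2) → Fin q,
      ((∏ i, if a * q + (a + b) ≤ q * f (i + 1) + f i then ε ^ (f i : ℕ) else 0) : ℤ) =
      fibSum (∑ u ∈ Ico (a + 1) q, ε ^ u) (ε ^ a * ∑ u ∈ Ico (a + b) q, ε ^ u) (m + 2) +
        ε ^ a * (∑ u ∈ Ico (a + b) q, ε ^ u) *
          fibSum (∑ u ∈ Ico (a + 1) q, ε ^ u) (ε ^ a * ∑ u ∈ Ico (a + b) q, ε ^ u) m := by
  set P : Matrix (Fin q) (Fin 2) ℤ :=
    Matrix.of fun u c => ![if a + b ≤ (u : ℕ) then ε ^ (u : ℕ) else 0, ε ^ (u : ℕ)] c with hP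
  set S : Matrix (Fin 2) (Fin q) ℤ :=
    Matrix.of fun c v => ![if (v : ℕ) = a then 1 else 0, if a < (v : ℕ) then 1 else 0] c with hS
  have hPS (u v : Fin q) : (P * S) u v =
      if a * q + (a + b) ≤ q * v + u then ε ^ (u : ℕ) else 0 := by
    have hu := u.2
    have hiff : a * q + (a + b) ≤ q * v + u ↔ a < (v : ℕ) ∨ (v : ℕ) = a ∧ a + b ≤ (u : ℕ) := by
      rcases lt_trichotomy (v : ℕ) a with h | h | h
      · have : q * (v + 1) ≤ q * a := Nat.mul_le_mul_left q h
        constructor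
        · intro h'; nlinarith
        · omega
      · rw [h, mul_comm]; omega
      · have : q * (a + 1) ≤ q * v := Nat.mul_le_mul_left q h
        constructor
        · omega
        · intro _; nlinarith [Nat.sub_le q 1]
    simp only [hiff, hP, hS, Matrix.mul_apply, Fin.sum_univ_two, Matrix.of_apply,
      Matrix.cons_val_zero, Matrix.cons_val_one]
    rcases lt_trichotomy (v : ℕ) a with h | h | h
    · simp [h.ne, h.not_gt]
    · simp [h]
    · simp [h, h.ne']
  have hsum (p : ℕ → Prop) [DecidablePred p] (c : ℕ) (hp : ∀ u, p u ↔ c ≤ u) :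
      ∑ u : Fin q, (if p u then ε ^ (u : ℕ) else 0) = ∑ u ∈ Ico c q, ε ^ u := by
    rw [Fin.sum_univ_eq_sum_range (fun u => if p u then ε ^ u else 0), ← Finset.sum_filter]
    refine Finset.sum_congr ?_ fun _ _ => rfl
    ext u
    simp [hp, and_comm]
  have hSP : S * P = !![0, ε ^ a; ∑ u ∈ Ico (a + b) q, ε ^ u, ∑ u ∈ Ico (a + 1) q, ε ^ u] := by
    ext i j
    fin_cases i <;> fin_cases j <;>
      simp only [hP, hS, Matrix.mul_apply, Matrix.of_apply, Fin.zero_eta, Fin.mk_one,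
        Matrix.cons_val_zero, Matrix.cons_val_one, ite_mul, one_mul, zero_mul]
    · refine Finset.sum_eq_zero fun u _ => ?_
      split_ifs <;> first | rfl | omega
    · rw [Finset.sum_eq_single_of_mem (⟨a, by omega⟩ : Fin q) (Finset.mem_univ _)]
      · simp
      · intro u _ hu
        rw [if_neg fun h => hu (Fin.ext h)]
    · rw [← hsum (fun u => a + b ≤ u) _ fun _ => Iff.rfl]
      refine Finset.sum_congr rfl fun u _ => ?_
      split_ifs <;> first | rfl | omega
    · exact hsum (fun u => a < u) _ fun _ => Iff.rfl
  have hcomm (n : ℕ) : (P * S) ^ n * P = P * (S * P) ^ n := by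
    induction n with
    | zero => simp
    | succ n ih => rw [pow_succ', pow_succ', Matrix.mul_assoc, ih]; simp only [Matrix.mul_assoc]
  have htr : ((P * S) ^ (m + 2)).trace = ((S * P) ^ (m + 2)).trace := by
    rw [pow_succ, ← Matrix.mul_assoc, hcomm, Matrix.mul_assoc, Matrix.trace_mul_comm,
      Matrix.mul_assoc, ← pow_succ]
  rw [← trace_pow_add_two_fin_two, ← hSP, ← htr, trace_pow_succ_eq_sum_cyclic]
  simp only [hPS]

theorem card_odd_cyclic_words {q a b m : ℕ} (hq : Odd q) (hb : 1 ≤ b) (hab : a + b ≤ q - 1)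
    (hm : Even m) :
    #{f : Fin (m + 2) → Fin q | Odd (∑ i, (f i : ℕ)) ∧
        ∀ i, a * q + (a + b) ≤ q * f (i + 1) + f i} =
      ∑ t ∈ Finset.range ((m + 2) / 2 + 1),
      (m + 2) * Nat.choose (m + 2 - t) t / (m + 2 - t) *
        ∑ j ∈ Finset.range (t + 1),
          Nat.choose t j * ((q - a - b) / 2) ^ j * ((q - a - b + 1) / 2) ^ (t - j) *
            (if (if Odd a then (t + j) % 2 = 1 else j % 2 = 1) then
              ∑ i ∈ Finset.range ((m + 2) / 2 - t + 1),
                Nat.choose (m + 2 - 2 * t) (2 * i) * ((q - a - 1) / 2) ^ (2 * i) *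
                  ((q - a) / 2) ^ (m + 2 - 2 * t - 2 * i)
            else
              ∑ i ∈ Finset.range ((m + 2) / 2 - t),
                Nat.choose (m + 2 - 2 * t) (2 * i + 1) * ((q - a - 1) / 2) ^ (2 * i + 1) *
                  ((q - a) / 2) ^ (m + 2 - 2 * t - 2 * i - 1)) := by
  set e : ℕ := (q - a) / 2 with he
  set o : ℕ := (q - a - 1) / 2 with ho
  set e' : ℕ := (q - a - b + 1) / 2 with he'
  set o' : ℕ := (q - a - b) / 2 with ho'
  have hcount : 2 * (#{f : Fin (m + 2) → Fin q | Odd (∑ i, (f i : ℕ)) ∧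
      ∀ i, a * q + (a + b) ≤ q * f (i + 1) + f i} : ℤ) =
      (∑ f : Fin (m + 2) → Fin q,
        ((∏ i, if a * q + (a + b) ≤ q * f (i + 1) + f i then 1 ^ (f i : ℕ) else 0) : ℤ)) -
      ∑ f : Fin (m + 2) → Fin q,
        ((∏ i, if a * q + (a + b) ≤ q * f (i + 1) + f i then (-1) ^ (f i : ℕ) else 0) : ℤ) := by
    rw [Finset.card_filter, ← Finset.sum_sub_distrib, Nat.cast_sum, Finset.mul_sum]
    refine Finset.sum_congr rfl fun f _ => ?_
    rw [Finset.prod_ite_zero, Finset.prod_ite_zero, Finset.prod_pow_eq_pow_sum,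
      Finset.prod_pow_eq_pow_sum]
    by_cases h : ∀ i, a * q + (a + b) ≤ q * f (i + 1) + f i
    · by_cases h' : Odd (∑ i, (f i : ℕ))
      · simp [h, h', h'.neg_one_pow]
      · simp [h, h', (Nat.not_odd_iff_even.1 h').neg_one_pow]
    · simp [h]
  have hone (c : ℕ) (hc : c ≤ q) :
      ∑ u ∈ Ico c q, (1 : ℤ) ^ u = ((q - c + 1) / 2 : ℕ) + ((q - c) / 2 : ℕ) := by
    simp only [one_pow, Finset.sum_const, Nat.card_Ico, nsmul_eq_mul, mul_one]
    omega
  have h1 : q - (a + 1) + 1 = q - a := by omega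
  have h2 : q - (a + 1) = q - a - 1 := by omega
  have h3 : q - (a + b) = q - a - b := by omega
  rw [sum_cyclic_words_prod_pow hb hab, sum_cyclic_words_prod_pow hb hab, hone _ (by omega),
    hone _ (by omega), sum_Ico_neg_one_pow hq (by omega), sum_Ico_neg_one_pow hq (by omega),
    h1, h2, h3, ← he, ← ho, ← he', ← ho', ← lucas_sum_eq, ← lucas_sum_eq,
    ← Finset.sum_sub_distrib] at hcount
  refine Nat.eq_of_mul_eq_mul_left zero_lt_two ?_
  rw [← Nat.cast_inj (R := ℤ), Nat.cast_mul, Nat.cast_ofNat, hcount, Nat.cast_mul, Nat.cast_sum,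
    Nat.cast_ofNat, Finset.mul_sum]
  refine Finset.sum_congr rfl fun t ht => ?_
  have hs : m + 2 - 2 * t = 2 * ((m + 2) / 2 - t) := by
    obtain ⟨r, rfl⟩ := hm
    omega
  rw [← mul_sub, one_pow, one_mul, Nat.cast_mul, mul_left_comm, hs,
    ← two_mul_sum_choose_parity_part]
  push_cast
  rfl

/-- The value of the `j`-th cyclic shift of the base-`q` digit string of period `m`. -/
def shiftVal (q m : ℕ) (g : ℕ → ℕ) (j : ℕ) : ℕ := ∑ i ∈ range m, g (i + j) * q ^ i

theorem shiftVal_modEq {q m : ℕ} {g : ℕ → ℕ} (hq : 0 < q) (hg : ∀ i, g (i + m) = g i) (j k : ℕ) :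
    shiftVal q m g j ≡ shiftVal q m g (j + k) * q ^ k [MOD q ^ m - 1] := by
  have hqm : q ^ m ≡ 1 [MOD q ^ m - 1] :=
    ((Nat.modEq_iff_dvd' (Nat.one_le_pow _ _ hq)).2 dvd_rfl).symm
  have hstep (j : ℕ) : shiftVal q m g j ≡ shiftVal q m g (j + 1) * q [MOD q ^ m - 1] := by
    have h : shiftVal q m g (j + 1) * q + g j * 1 = shiftVal q m g j + g j * q ^ m := by
      have h1 := Finset.sum_range_succ (fun i => g (i + j) * q ^ i) m
      rw [Finset.sum_range_succ', add_comm m j, hg, zero_add, pow_zero] at h1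
      rw [shiftVal, shiftVal, ← h1, Finset.sum_mul]
      congr 1
      refine Finset.sum_congr rfl fun i _ => ?_
      rw [pow_succ, mul_assoc, add_right_comm, add_assoc]
    have h2 : shiftVal q m g (j + 1) * q + g j * 1 ≡ shiftVal q m g j + g j * 1 [MOD q ^ m - 1] :=
      h ▸ (hqm.mul_left _).add_left _
    exact (Nat.ModEq.add_right_cancel' _ h2).symm
  induction k with
  | zero => simp [Nat.ModEq.refl]
  | succ k ih =>
    refine ih.trans ?_
    rw [pow_succ', ← mul_assoc, ← add_assoc]
    exact (hstep _).mul_right _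

theorem shiftVal_add_mul_period {q m : ℕ} {g : ℕ → ℕ} (hg : ∀ i, g (i + m) = g i) (j k : ℕ) :
    shiftVal q m g (j + m * k) = shiftVal q m g j := by
  have h (i : ℕ) : g (i + m * k) = g i := by
    induction k with
    | zero => rfl
    | succ k ih => rw [mul_add, mul_one, ← add_assoc, hg, ih]
  simp only [shiftVal, ← add_assoc, h]

theorem shiftVal_lt {q m : ℕ} {g : ℕ → ℕ} (hg : ∀ i, g i < q) (j : ℕ) :
    shiftVal q m g j < q ^ m := by
  induction m with
  | zero => simp [shiftVal]
  | succ m ih =>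
    rw [shiftVal, Finset.sum_range_succ, ← shiftVal, pow_succ']
    nlinarith [Nat.mul_le_mul_right (q ^ m) (Nat.succ_le_of_lt (hg (m + j)))]

theorem odd_shiftVal_iff {q m : ℕ} {g : ℕ → ℕ} (hq : Odd q) (j : ℕ) :
    Odd (shiftVal q m g j) ↔ Odd (∑ i ∈ range m, g (i + j)) := by
  rw [shiftVal, Finset.odd_sum_iff_odd_card_odd, Finset.odd_sum_iff_odd_card_odd]
  simp [Nat.odd_mul, hq.pow]

theorem sum_range_shift_of_periodic {m : ℕ} {g : ℕ → ℕ} (hg : ∀ i, g (i + m) = g i) (j : ℕ) :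
    ∑ i ∈ range m, g (i + j) = ∑ i ∈ range m, g i := by
  induction j with
  | zero => rfl
  | succ j ih =>
    have h1 := Finset.sum_range_succ (fun i => g (i + j)) m
    rw [Finset.sum_range_succ', add_comm m j, hg, zero_add] at h1
    rw [← ih, ← Nat.add_right_cancel h1]
    exact Finset.sum_congr rfl fun i _ => by rw [add_right_comm, add_assoc]

theorem le_shiftVal_of_le_pairs {q c s : ℕ} {g : ℕ → ℕ} (hc : ∀ i, c ≤ q * g (i + 1) + g i)
    (j : ℕ) : c * ∑ i ∈ range s, (q ^ 2) ^ i ≤ shiftVal q (2 * s) g j := by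
  induction s with
  | zero => simp
  | succ s ih =>
    have h : shiftVal q (2 * (s + 1)) g j = shiftVal q (2 * s) g j +
        (q * g (2 * s + j + 1) + g (2 * s + j)) * (q ^ 2) ^ s := by
      rw [shiftVal, show 2 * (s + 1) = 2 * s + 1 + 1 by ring, Finset.sum_range_succ,
        Finset.sum_range_succ, ← shiftVal, add_right_comm _ 1 j]
      ring
    rw [h, Finset.sum_range_succ, mul_add]
    exact Nat.add_le_add ih (Nat.mul_le_mul_right _ (hc _))

/-- All cyclic shifts of a word of length `2 s` are at least the word with repeated digit pair
`c` exactly when all its adjacent digit pairs are at least `c`. -/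
theorem forall_le_shiftVal_iff {q c s : ℕ} {g : ℕ → ℕ} (hs : 0 < s)
    (hgq : ∀ i, g i < q) (hg : ∀ i, g (i + 2 * s) = g i) :
    (∀ j, c * ∑ i ∈ range s, (q ^ 2) ^ i ≤ shiftVal q (2 * s) g j) ↔
      ∀ i, c ≤ q * g (i + 1) + g i := by
  refine ⟨fun h i => ?_, fun h => le_shiftVal_of_le_pairs h⟩
  obtain ⟨r, rfl⟩ : ∃ r, s = r + 1 := ⟨s - 1, by omega⟩
  have h1 := h (i + 2)
  have h2 : shiftVal q (2 * (r + 1)) g (i + 2) < (q * g (i + 1) + g i + 1) * (q ^ 2) ^ r := by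
    rw [shiftVal, show 2 * (r + 1) = 2 * r + 1 + 1 by ring, Finset.sum_range_succ,
        Finset.sum_range_succ, ← shiftVal, show 2 * r + 1 + (i + 2) = i + 1 + 2 * (r + 1) by ring,
        show 2 * r + (i + 2) = i + 2 * (r + 1) by ring, hg, hg]
    have := shiftVal_lt (m := 2 * r) hgq (i + 2)
    rw [← pow_mul, pow_succ]
    linarith
  rw [Finset.sum_range_succ, mul_add] at h1
  exact Nat.le_of_lt_succ
    (Nat.lt_of_mul_lt_mul_right (((Nat.le_add_left _ _).trans h1).trans_lt h2))

theorem forall_le_mod_iff {q c s : ℕ} {g : ℕ → ℕ} (hq : Odd q) (hs : 0 < s)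
    (hgq : ∀ i, g i < q) (hg : ∀ i, g (i + 2 * s) = g i) (hodd : Odd (shiftVal q (2 * s) g 0)) :
    (∀ j, c * ∑ i ∈ range s, (q ^ 2) ^ i ≤ shiftVal q (2 * s) g 0 * q ^ j % (q ^ (2 * s) - 1)) ↔
      ∀ i, c ≤ q * g (i + 1) + g i := by
  rw [← forall_le_shiftVal_iff hs hgq hg]
  have hlt (j : ℕ) : shiftVal q (2 * s) g j < q ^ (2 * s) - 1 := by
    have h1 := shiftVal_lt (m := 2 * s) hgq j
    have h2 : Odd (shiftVal q (2 * s) g j) := by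
      rw [odd_shiftVal_iff hq] at hodd ⊢
      rwa [sum_range_shift_of_periodic hg] at hodd ⊢
    have h3 : Odd (q ^ (2 * s)) := hq.pow
    grind
  have key (j : ℕ) : shiftVal q (2 * s) g ((2 * s - 1) * j) =
      shiftVal q (2 * s) g 0 * q ^ j % (q ^ (2 * s) - 1) := by
    have h := shiftVal_modEq hq.pos hg ((2 * s - 1) * j) j
    rw [← Nat.succ_mul, Nat.succ_eq_add_one, Nat.sub_add_cancel (by omega),
      ← zero_add (2 * s * j), shiftVal_add_mul_period hg] at h
    rw [← h, Nat.mod_eq_of_lt (hlt _)]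
  have hperm (j : ℕ) : shiftVal q (2 * s) g ((2 * s - 1) * ((2 * s - 1) * j)) =
      shiftVal q (2 * s) g j := by
    rw [← shiftVal_add_mul_period hg j ((2 * s - 2) * j)]
    congr 1
    obtain ⟨r, hr⟩ : ∃ r, 2 * s = r + 2 := ⟨2 * s - 2, by omega⟩
    rw [hr, show r + 2 - 1 = r + 1 by omega, Nat.add_sub_cancel]
    ring
  refine ⟨fun h j => ?_, fun h j => key j ▸ h _⟩
  rw [← hperm, key]
  exact h _

open Classical in
theorem card_odd_forall_le_mod {q c m : ℕ} (hq : Odd q) (hm : Even m) :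
    #{x ∈ range (q ^ (m + 2) - 1) | Odd x ∧
        ∀ j, c * ∑ i ∈ range ((m + 2) / 2), (q ^ 2) ^ i ≤ x * q ^ j % (q ^ (m + 2) - 1)} =
      #{f : Fin (m + 2) → Fin q | Odd (∑ i, (f i : ℕ)) ∧ ∀ i, c ≤ q * f (i + 1) + f i} := by
  symm
  have main (f : Fin (m + 2) → Fin q) :
      (Odd (finFunctionFinEquiv f : ℕ) ↔ Odd (∑ i, (f i : ℕ))) ∧
      (Odd (finFunctionFinEquiv f : ℕ) →
        ((∀ j, c * ∑ i ∈ range ((m + 2) / 2), (q ^ 2) ^ i ≤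
          (finFunctionFinEquiv f : ℕ) * q ^ j % (q ^ (m + 2) - 1)) ↔
        ∀ i, c ≤ q * f (i + 1) + f i)) := by
    set g : ℕ → ℕ := fun i => f ⟨i % (m + 2), Nat.mod_lt _ (by omega)⟩ with hgdef
    have hgf (i : Fin (m + 2)) : g i = f i := by
      simp only [hgdef, Nat.mod_eq_of_lt i.2]
    have hval : (finFunctionFinEquiv f : ℕ) = shiftVal q (m + 2) g 0 := by
      rw [finFunctionFinEquiv_apply, shiftVal, ← Fin.sum_univ_eq_sum_range
        (fun i => g (i + 0) * q ^ i)]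
      exact Finset.sum_congr rfl fun i _ => by rw [add_zero, hgf]
    have hsum : ∑ i, (f i : ℕ) = ∑ i ∈ range (m + 2), g (i + 0) := by
      rw [← Fin.sum_univ_eq_sum_range (fun i => g (i + 0))]
      exact Finset.sum_congr rfl fun i _ => by rw [add_zero, hgf]
    have hpairs : (∀ i, c ≤ q * f (i + 1) + f i) ↔ ∀ i, c ≤ q * g (i + 1) + g i := by
      have hsucc (i : ℕ) : g (i + 1) = f (⟨i % (m + 2), Nat.mod_lt _ (by omega)⟩ + 1) := by
        simp only [hgdef]
        congr 2
        ext
        simp [Fin.val_add]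
      refine ⟨fun h i => hsucc i ▸ h _, fun h i => ?_⟩
      have := h i
      rw [hsucc, hgf] at this
      simpa only [Nat.mod_eq_of_lt i.2] using this
    rw [hval, hsum, hpairs]
    refine ⟨odd_shiftVal_iff hq 0, fun hodd => ?_⟩
    have h2s : m + 2 = 2 * ((m + 2) / 2) := by
      obtain ⟨r, rfl⟩ := hm
      omega
    have hper (i : ℕ) : g (i + 2 * ((m + 2) / 2)) = g i := by
      rw [← h2s]
      simp [hgdef]
    rw [h2s] at hodd
    have := forall_le_mod_iff (c := c) hq (by omega) (fun i => (f _).2) hper hodd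
    rwa [← h2s] at this
  refine Finset.card_bij (fun f _ => (finFunctionFinEquiv f : ℕ)) (fun f hf => ?_)
    (fun f _ f' _ h => finFunctionFinEquiv.injective (Fin.ext h)) (fun x hx => ?_)
  · simp only [Finset.mem_filter, Finset.mem_univ, true_and] at hf
    have hodd := (main f).1.2 hf.1
    simp only [Finset.mem_filter, Finset.mem_range]
    refine ⟨?_, hodd, ((main f).2 hodd).2 hf.2⟩
    have h1 := (finFunctionFinEquiv f).2
    have h3 : Odd (q ^ (m + 2)) := hq.pow
    grind
  · simp only [Finset.mem_filter, Finset.mem_range] at hx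
    obtain ⟨f, hf⟩ := finFunctionFinEquiv.surjective (⟨x, by omega⟩ : Fin (q ^ (m + 2)))
    have hfx : (finFunctionFinEquiv f : ℕ) = x := by rw [hf]
    have := main f
    rw [hfx] at this
    refine ⟨f, ?_, hfx⟩
    simp only [Finset.mem_filter, Finset.mem_univ, true_and]
    exact ⟨this.1.1 hx.2.1, (this.2 hx.2.1).1 hx.2.2⟩

open Polynomial in
theorem mem_range_algebraMap_of_pow_card_eq {F E : Type*} [Field F] [Fintype F] [Field E]
    [Algebra F E] {z : E} (hz : z ^ Fintype.card F = z) : z ∈ Set.range (algebraMap F E) := by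
  have hroots : (X ^ Fintype.card F - X : F[X]).roots = Finset.univ.val :=
    FiniteField.roots_X_pow_card_sub_X F
  have hprod : ∏ x : F, (X - C x) = X ^ Fintype.card F - X := by
    rw [Finset.prod, ← hroots]
    refine prod_multiset_X_sub_C_of_monic_of_roots_card_eq
      (monic_X_pow_sub (by simpa using Fintype.one_lt_card)) ?_
    rw [hroots, FiniteField.X_pow_card_sub_X_natDegree_eq F Fintype.one_lt_card]
    rfl
  have h := congrArg (fun p : F[X] => (p.map (algebraMap F E)).eval z) hprod
  simp only [Polynomial.map_prod, eval_prod, Polynomial.map_sub, map_X, map_C, eval_sub, eval_X,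
    eval_C, Polynomial.map_pow, eval_pow, hz, sub_self, Finset.prod_eq_zero_iff, sub_eq_zero] at h
  obtain ⟨x, _, hx⟩ := h
  exact ⟨x, hx.symm⟩

open Polynomial in
theorem evalAt_eq_eval_map {F E : Type*} [Field F] [Field E] [Algebra F E] (n : ℕ) (x : E)
    {p : F[X]} (hp : p.degree < n) :
    evalAt F n x (fun j => p.coeff j) = (p.map (algebraMap F E)).eval x := by
  rcases eq_or_ne p 0 with rfl | h
  · simp [evalAt]
  · have hmap : (p.map (algebraMap F E)).natDegree < n := by
      rwa [natDegree_map, natDegree_lt_iff_degree_lt h]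
    rw [eval_eq_sum_range' hmap]
    simp [evalAt, Algebra.smul_def, ← Fin.sum_univ_eq_sum_range]

open Polynomial in
/-- The product of `X - z` over a finite set closed under the Frobenius of a finite subfield
descends to the subfield. -/
theorem exists_map_eq_prod_X_sub_C {F E : Type*} [Field F] [Fintype F] [Field E] [Algebra F E]
    (Z : Finset E) (hZ : Set.MapsTo (fun z : E => z ^ Fintype.card F) Z Z) :
    ∃ g : F[X], g.map (algebraMap F E) = ∏ z ∈ Z, (X - C z) := by
  set φ : E →+* E := (FiniteField.frobeniusAlgHom F E).toRingHom
  have hφa (z : E) : φ z = z ^ Fintype.card F := rfl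
  have hfix : (∏ z ∈ Z, (X - C z)).map φ = ∏ z ∈ Z, (X - C z) := by
    rw [Polynomial.map_prod]
    simp only [Polynomial.map_sub, map_X, map_C, hφa]
    classical
    have hinj : Set.InjOn (fun z : E => z ^ Fintype.card F) Z := φ.injective.injOn
    have himage : Z.image (fun z : E => z ^ Fintype.card F) = Z :=
      Finset.eq_of_subset_of_card_le (Finset.image_subset_iff.2 hZ)
        (Finset.card_image_of_injOn hinj).ge
    conv_rhs => rw [← himage, Finset.prod_image hinj]
  have hlift : (∏ z ∈ Z, (X - C z)) ∈ lifts (algebraMap F E) := by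
    rw [lifts_iff_coeff_lifts]
    intro i
    have h : φ ((∏ z ∈ Z, (X - C z)).coeff i) = (∏ z ∈ Z, (X - C z)).coeff i := by
      rw [← coeff_map, hfix]
    exact mem_range_algebraMap_of_pow_card_eq h
  obtain ⟨g, hg⟩ := (mem_lifts _).1 hlift
  exact ⟨g, hg⟩

open Polynomial in
theorem finrank_iInf_ker_evalAt {F E : Type*} [Field F] [Fintype F] [Field E] [Algebra F E]
    {n : ℕ} (Z : Finset E) (hZ : Set.MapsTo (fun z : E => z ^ Fintype.card F) Z Z)
    (hcard : #Z ≤ n) :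
    Module.finrank F (⨅ z ∈ Z, LinearMap.ker (evalAt F n z) : Submodule F (Fin n → F)) =
      n - #Z := by
  obtain ⟨g, hg⟩ := exists_map_eq_prod_X_sub_C (F := F) Z hZ
  have hg0 : g ≠ 0 := by
    rintro rfl
    rw [Polynomial.map_zero] at hg
    exact (monic_prod_X_sub_C (fun z => z) Z).ne_zero hg.symm
  have hdeg : g.degree = #Z := by
    rw [← degree_map g (algebraMap F E), hg, degree_prod]
    simp
  have hmuldeg (f : degreeLT F (n - #Z)) : ((f : F[X]) * g).degree < n := by
    have hf := mem_degreeLT.1 f.2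
    rcases eq_or_ne (f : F[X]) 0 with h | h
    · simp [h]
    · rw [← natDegree_lt_iff_degree_lt h] at hf
      rw [degree_mul, hdeg, degree_eq_natDegree h]
      norm_cast
      omega
  let Φ : degreeLT F (n - #Z) →ₗ[F] (Fin n → F) :=
    { toFun := fun f j => ((f : F[X]) * g).coeff j
      map_add' := fun f f' => by ext j; simp [add_mul]
      map_smul' := fun r f => by ext j; simp }
  have hΦ : Function.Injective Φ := by
    rw [injective_iff_map_eq_zero]
    intro f hf
    have h0 : (f : F[X]) * g = 0 := by
      ext j
      by_cases hj : j < n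
      · exact congrFun hf ⟨j, hj⟩
      · rw [coeff_zero]
        exact coeff_eq_zero_of_degree_lt ((hmuldeg f).trans_le (by exact_mod_cast not_lt.1 hj))
    exact Subtype.ext ((mul_eq_zero.1 h0).resolve_right hg0)
  have hrange : LinearMap.range Φ = ⨅ z ∈ Z, LinearMap.ker (evalAt F n z) := by
    ext c
    simp only [LinearMap.mem_range, Submodule.mem_iInf, LinearMap.mem_ker]
    constructor
    · rintro ⟨f, rfl⟩ z hz
      refine (evalAt_eq_eval_map n z (hmuldeg f)).trans ?_
      rw [Polynomial.map_mul, hg, eval_mul, eval_prod, Finset.prod_eq_zero hz (by simp), mul_zero]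
    · intro hc
      set p : F[X] := ((degreeLTEquiv F n).symm c : F[X]) with hp
      have hpdeg : p.degree < n := mem_degreeLT.1 ((degreeLTEquiv F n).symm c).2
      have hpc : (fun j : Fin n => p.coeff j) = c := (degreeLTEquiv F n).apply_symm_apply c
      have hdvd : g ∣ p := by
        rw [← map_dvd_map' (algebraMap F E), hg]
        refine Finset.prod_dvd_of_coprime
          (fun x _ y _ hxy => pairwise_coprime_X_sub_C Function.injective_id hxy) fun z hz => ?_
        rw [dvd_iff_isRoot, IsRoot.def, ← evalAt_eq_eval_map n z hpdeg, hpc]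
        exact hc z hz
      obtain ⟨f, hf⟩ := hdvd
      have hfdeg : f ∈ degreeLT F (n - #Z) := by
        rw [mem_degreeLT]
        rcases eq_or_ne f 0 with rfl | h
        · simp
        · rw [hf, degree_mul, hdeg, degree_eq_natDegree h] at hpdeg
          rw [degree_eq_natDegree h]
          norm_cast at hpdeg ⊢
          omega
      refine ⟨⟨f, hfdeg⟩, ?_⟩
      rw [← hpc, hf, mul_comm]
      rfl
  rw [← hrange, LinearMap.finrank_range_of_inj hΦ, (degreeLTEquiv F _).finrank_eq,
    Module.finrank_fin_fun]

open Polynomial in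
/-- The BCH bound for negacyclic codes. -/
theorem le_hWt_of_mem_negaBCH {F E : Type*} [Field F] [Field E] [Algebra F E] {n δ : ℕ} {γ : E}
    (hγ : IsPrimitiveRoot γ (2 * n)) (hδ : 2 ≤ δ) {c : Fin n → F} (hc : c ∈ negaBCH F n γ δ 0)
    (hc0 : c ≠ 0) : δ ≤ hWt c := by
  classical
  by_contra! hlt
  have hn : 0 < n := by
    obtain ⟨j, _⟩ := Function.ne_iff.1 hc0
    exact j.pos
  obtain ⟨j₀, hj₀⟩ := Function.ne_iff.1 hc0
  have hpoly (P : E[X]) (hP : P.natDegree ≤ δ - 2) :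
      ∑ j, algebraMap F E (c j) * γ ^ (j : ℕ) * P.eval (γ ^ (2 * (j : ℕ))) = 0 := by
    simp only [eval_eq_sum_range' (Nat.lt_succ_of_le hP), Finset.mul_sum]
    rw [Finset.sum_comm]
    refine Finset.sum_eq_zero fun i hi => ?_
    have hmem : evalAt F n (γ ^ (1 + 2 * i)) c = 0 := by
      simp only [negaBCH, Submodule.mem_iInf, LinearMap.mem_ker] at hc
      exact hc i (by simp only [Finset.mem_Icc, Finset.mem_range] at *; omega)
    have : P.coeff i * evalAt F n (γ ^ (1 + 2 * i)) c = 0 := by rw [hmem, mul_zero]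
    rw [← this, evalAt, LinearMap.coe_mk, AddHom.coe_mk, Finset.mul_sum]
    refine Finset.sum_congr rfl fun j _ => ?_
    rw [Algebra.smul_def, ← pow_mul, ← pow_mul]
    ring
  set s : Finset (Fin n) := ({j | c j ≠ 0} : Finset (Fin n)).erase j₀ with hs
  have hscard : #s ≤ δ - 2 := by
    have : #({j | c j ≠ 0} : Finset (Fin n)) = hWt c := by rw [hWt, hammingNorm]
    rw [hs, Finset.card_erase_of_mem (by simpa using hj₀), this]
    omega
  have h := hpoly (∏ j ∈ s, (X - C (γ ^ (2 * (j : ℕ))))) (by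
    rw [natDegree_prod_of_monic _ _ fun j _ => monic_X_sub_C _]
    simpa only [natDegree_X_sub_C, Finset.sum_const, smul_eq_mul, mul_one] using hscard)
  rw [Finset.sum_eq_single_of_mem j₀ (Finset.mem_univ _)] at h
  · have hγ0 : γ ≠ 0 := hγ.ne_zero (by omega)
    rcases mul_eq_zero.1 h with h | h
    · rcases mul_eq_zero.1 h with h | h
      · exact hj₀ (by simpa using h)
      · exact pow_ne_zero _ hγ0 h
    · rw [eval_prod, Finset.prod_eq_zero_iff] at h
      obtain ⟨j, hj, hj'⟩ := h
      rw [eval_sub, eval_X, eval_C, sub_eq_zero] at hj'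
      have := hγ.pow_inj (by omega) (by omega) hj'
      exact (Finset.mem_erase.1 hj).1 (Fin.ext (by omega))
  · intro j _ hj
    by_cases hcj : c j = 0
    · simp [hcj]
    · rw [eval_prod, Finset.prod_eq_zero (i := j) (by simp [hs, hj, hcj]) (by simp), mul_zero]

theorem evalAt_pow_card_pow {F E : Type*} [Field F] [Fintype F] [Field E] [Algebra F E] {n : ℕ}
    (x : E) (c : Fin n → F) (j : ℕ) :
    evalAt F n (x ^ Fintype.card F ^ j) c = evalAt F n x c ^ Fintype.card F ^ j := by
  have h (x : E) : evalAt F n (x ^ Fintype.card F) c = evalAt F n x c ^ Fintype.card F := by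
    have h := map_sum (FiniteField.frobeniusAlgHom F E) (fun j : Fin n => c j • x ^ (j : ℕ)) univ
    simp only [map_smul, map_pow, FiniteField.coe_frobeniusAlgHom] at h
    exact h.symm
  induction j with
  | zero => simp
  | succ j ih => rw [pow_succ, pow_mul, h, ih, ← pow_mul]

theorem card_filter_odd_range_two_mul (n : ℕ) : #{x ∈ range (2 * n) | Odd x} = n := by
  induction n with
  | zero => rfl
  | succ n ih =>
    rw [show 2 * (n + 1) = 2 * n + 1 + 1 by ring, Finset.range_add_one, Finset.range_add_one,
      Finset.filter_insert, Finset.filter_insert, if_pos (odd_two_mul_add_one n),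
      if_neg (by simp), Finset.card_insert_of_notMem (by simp), ih]

open Classical in
theorem finrank_negaBCH_zero {F E : Type*} [Field F] [Fintype F] [Field E] [Algebra F E]
    {n m d : ℕ} {γ : E} (hγ : IsPrimitiveRoot γ (2 * n)) (hq : Odd (Fintype.card F))
    (hm : 0 < m) (hn : 2 * n = Fintype.card F ^ m - 1) (hd : 2 ≤ d) (hdn : d ≤ 2 * n) :
    Module.finrank F (negaBCH F n γ ((d + 2) / 2) 0) =
      #{x ∈ range (2 * n) | Odd x ∧ ∀ j, d ≤ x * Fintype.card F ^ j % (2 * n)} := by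
  set q := Fintype.card F
  set T : Finset ℕ := {x ∈ range (2 * n) | Odd x ∧ ¬ ∀ j, d ≤ x * q ^ j % (2 * n)} with hT
  set Z : Finset E := T.image (γ ^ ·)
  have hcardZ : #Z = #T := Finset.card_image_of_injOn fun x hx y hy h =>
    hγ.pow_inj (Finset.mem_range.1 (Finset.mem_filter.1 hx).1)
      (Finset.mem_range.1 (Finset.mem_filter.1 hy).1) h
  have hsplit : #{x ∈ range (2 * n) | Odd x ∧ ∀ j, d ≤ x * q ^ j % (2 * n)} + #T = n := by
    conv_rhs => rw [← card_filter_odd_range_two_mul n]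
    rw [← Finset.card_filter_add_card_filter_not (s := {x ∈ range (2 * n) | Odd x})
      (fun x => ∀ j, d ≤ x * q ^ j % (2 * n)), Finset.filter_filter, Finset.filter_filter]
  have hoddmod {x : ℕ} (hx : Odd x) (j : ℕ) : Odd (x * q ^ j % (2 * n)) := by
    rw [Nat.odd_iff, Nat.mod_mul_right_mod, ← Nat.odd_iff]
    exact hx.mul hq.pow
  have hqm : q ^ m ≡ 1 [MOD 2 * n] :=
    ((Nat.modEq_iff_dvd' (Nat.one_le_pow _ _ hq.pos)).2 hn.dvd).symm
  have hmaps : Set.MapsTo (fun z : E => z ^ q) Z Z := by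
    intro z hz
    obtain ⟨x, hx, rfl⟩ := Finset.mem_image.1 hz
    simp only [hT, Finset.mem_filter, Finset.mem_range, not_forall, not_le] at hx
    obtain ⟨hxn, hxo, j, hj⟩ := hx
    refine Finset.mem_image.2 ⟨x * q % (2 * n), ?_, ?_⟩
    · simp only [hT, Finset.mem_filter, Finset.mem_range, not_forall, not_le]
      refine ⟨Nat.mod_lt _ (by omega), by simpa using hoddmod hxo 1, j + (m - 1), ?_⟩
      have : x * q % (2 * n) * q ^ (j + (m - 1)) ≡ x * q ^ j [MOD 2 * n] := by
        refine ((Nat.mod_modEq _ _).mul_right _).trans ?_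
        have h := hqm.mul_left (x * q ^ j)
        rw [mul_one] at h
        convert h using 1
        obtain ⟨r, rfl⟩ : ∃ r, m = r + 1 := ⟨m - 1, by omega⟩
        rw [Nat.add_sub_cancel]
        ring
      rwa [this]
    · simp only [← pow_mul]
      rw [hγ.eq_orderOf, pow_mod_orderOf]
  have hcode : negaBCH F n γ ((d + 2) / 2) 0 = ⨅ z ∈ Z, LinearMap.ker (evalAt F n z) := by
    ext c
    simp only [negaBCH, Submodule.mem_iInf, LinearMap.mem_ker, Finset.mem_Icc]
    constructor
    · intro hc z hz
      obtain ⟨x, hx, rfl⟩ := Finset.mem_image.1 hz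
      simp only [hT, Finset.mem_filter, Finset.mem_range, not_forall, not_le] at hx
      obtain ⟨hxn, hxo, j, hj⟩ := hx
      obtain ⟨i, hi⟩ := hoddmod hxo j
      have h := hc i (by omega)
      rw [add_comm 1, ← hi, hγ.eq_orderOf, pow_mod_orderOf, pow_mul, evalAt_pow_card_pow] at h
      exact eq_zero_of_pow_eq_zero h
    · intro hc i hi
      refine hc _ (Finset.mem_image.2 ⟨1 + 2 * i, ?_, rfl⟩)
      simp only [hT, Finset.mem_filter, Finset.mem_range, not_forall, not_le]
      refine ⟨by omega, by rw [add_comm]; exact odd_two_mul_add_one i, 0, ?_⟩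
      rw [pow_zero, mul_one, Nat.mod_eq_of_lt (by omega)]
      omega
  rw [hcode, finrank_iInf_ker_evalAt Z hmaps (by omega)]
  omega

theorem sq_sub_one_mul_geom_sum {q : ℕ} (hq : 0 < q) (s : ℕ) :
    (q ^ 2 - 1) * ∑ i ∈ range s, (q ^ 2) ^ i = q ^ (2 * s) - 1 := by
  have h := geom_sum_mul_add (q ^ 2 - 1) s
  rw [Nat.sub_add_cancel (Nat.one_le_pow _ _ hq), ← pow_mul] at h
  rw [← h, Nat.add_sub_cancel, mul_comm]

theorem repeated_pair_eq {q a b s : ℕ} (hq : 2 ≤ q) :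
    a * (q ^ (2 * s) - 1) / (q - 1) + b * (q ^ (2 * s) - 1) / (q ^ 2 - 1) =
      (a * q + (a + b)) * ∑ i ∈ range s, (q ^ 2) ^ i := by
  have hfac : q ^ 2 - 1 = (q - 1) * (q + 1) := by
    rw [mul_comm, ← Nat.sq_sub_sq, one_pow]
  have h1 : 0 < q - 1 := by omega
  rw [← sq_sub_one_mul_geom_sum (by omega), hfac, mul_left_comm b, Nat.mul_div_cancel_left _ (by positivity), mul_assoc,
    mul_left_comm a, Nat.mul_div_cancel_left _ h1]
  ring

theorem stmt_2 (q m a b n δt δ k : ℕ)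
    (hq : ∃ p e : ℕ, p.Prime ∧ Odd p ∧ 0 < e ∧ q = p ^ e)
    (hq3 : 3 ≤ q) (hm : 2 < m) (hme : Even m)
    (ha1 : 1 ≤ a) (hb1 : 1 ≤ b) (hab : a + b ≤ q - 1)
    (hcond : 1 ≤ (q - a - 1) / 2)
    (hn : 2 * n = q ^ m - 1)
    (hδt : δt = a * (q ^ m - 1) / (q - 1) + b * (q ^ m - 1) / (q ^ 2 - 1))
    (hδ : δ = (δt + 2) / 2)
    (hk : k = ∑ t ∈ Finset.range (m / 2 + 1),
      m * Nat.choose (m - t) t / (m - t) *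
        ∑ j ∈ Finset.range (t + 1),
          Nat.choose t j * ((q - a - b) / 2) ^ j * ((q - a - b + 1) / 2) ^ (t - j) *
            (if (if Odd a then (t + j) % 2 = 1 else j % 2 = 1) then
              ∑ i ∈ Finset.range (m / 2 - t + 1),
                Nat.choose (m - 2 * t) (2 * i) * ((q - a - 1) / 2) ^ (2 * i) *
                  ((q - a) / 2) ^ (m - 2 * t - 2 * i)
            else
              ∑ i ∈ Finset.range (m / 2 - t),
                Nat.choose (m - 2 * t) (2 * i + 1) * ((q - a - 1) / 2) ^ (2 * i + 1) *
                  ((q - a) / 2) ^ (m - 2 * t - 2 * i - 1)))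
    (F E : Type*) [Field F] [Fintype F] [Field E] [Algebra F E]
    (hF : Fintype.card F = q)
    (γ : E) (hγ : IsPrimitiveRoot γ (2 * n)) :
    (∀ c ∈ negaBCH F n γ δ 0, c ≠ 0 → δ ≤ hWt c) ∧
    Module.finrank F (negaBCH F n γ δ 0) = k := by
  classical
  have hqodd : Odd q := by
    obtain ⟨p, e, _, hp, _, rfl⟩ := hq
    exact hp.pow
  obtain ⟨r, rfl⟩ : ∃ r, m = r + 2 := ⟨m - 2, by omega⟩
  have hr : Even r := by simpa [Nat.even_add] using hme
  set s := (r + 2) / 2 with hs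
  have h2s : 2 * s = r + 2 := by
    obtain ⟨u, rfl⟩ := hr
    omega
  set G := ∑ i ∈ range s, (q ^ 2) ^ i with hG
  have hd : δt = (a * q + (a + b)) * G := by
    rw [hδt, ← h2s, repeated_pair_eq (by omega)]
  have hG1 : 1 ≤ G := by
    have := Finset.single_le_sum (f := fun i => (q ^ 2) ^ i) (fun _ _ => Nat.zero_le _)
      (Finset.mem_range.2 (show 0 < s by omega))
    simpa using this
  have hd2 : 2 ≤ δt := by
    rw [hd]
    exact (show 2 ≤ a * q + (a + b) by omega).trans (Nat.le_mul_of_pos_right _ hG1)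
  have hdn : δt ≤ 2 * n := by
    rw [hn, ← h2s, hd, ← sq_sub_one_mul_geom_sum (by omega)]
    refine Nat.mul_le_mul_right _ (Nat.le_sub_of_add_le ?_)
    obtain ⟨v, rfl⟩ : ∃ v, q = v + 2 := ⟨q - 2, by omega⟩
    have : a * (v + 2) ≤ v * (v + 2) := Nat.mul_le_mul_right _ (by omega)
    nlinarith [show a + b ≤ v + 1 by omega]
  refine ⟨fun c hc hc0 => le_hWt_of_mem_negaBCH hγ (by omega) hc hc0, ?_⟩
  subst hF
  rw [hδ, finrank_negaBCH_zero hγ hqodd (by omega) hn hd2 hdn, hk,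
    ← card_odd_cyclic_words hqodd hb1 hab hr, ← card_odd_forall_le_mod hqodd hr, hn, hd]
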